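/- The following are equivalent: (1) every strong measure zero subset of ℝ is countable; (2) every meager-additive subset of ℝ is countable. -/

import Mathlib

open Pointwise

/-- A subset `X` of `ℝ` has strong measure zero if for every sequence `(ε n)` of
positive reals there is a sequence `(U n)` of subsets of `ℝ` with `diam (U n) ≤ ε n`
for every `n` whose union covers `X`. -/
def HasStrongMeasureZero (X : Set ℝ) : Prop :=
  ∀ ε : ℕ → ℝ, (∀ n, 0 < ε n) →
    ∃ U : ℕ → Set ℝ, (∀ n, EMetric.diam (U n) ≤ ENNReal.ofReal (ε n)) ∧ X ⊆ ⋃ n, U n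

/-- A subset `X` of `ℝ` is meager-additive if `X + M` is meager for every meager
`M ⊆ ℝ`. -/
def IsMeagerAdditive (X : Set ℝ) : Prop :=
  ∀ M : Set ℝ, IsMeagre M → IsMeagre (X + M)

open Set Filter Topology

/-- A set of reals has the Hurewicz-type property that whenever each of its points lies in
infinitely many members of a sequence of open sets, there is a single function `g` such that
almost every interval `[n, g n)` contains the index of a member through the point. -/
def HasHurewiczProperty (X : Set ℝ) : Prop :=
  ∀ S : ℕ → Set ℝ, (∀ k, IsOpen (S k)) → (∀ x ∈ X, ∃ᶠ k in atTop, x ∈ S k) →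
    ∃ g : ℕ → ℕ, ∀ x ∈ X, ∀ᶠ n in atTop, ∃ k, n ≤ k ∧ k < g n ∧ x ∈ S k

/-- `X` contains a sequence `e` such that for every choice of radii all but countably many
points of `X` are uniformly often approximated by terms of `e` within these radii. -/
def IsUniformlyConcentrated (X : Set ℝ) : Prop :=
  ∃ e : ℕ → ℝ, (∀ i, e i ∈ X) ∧ ∀ r : ℕ → ℝ, (∀ i, 0 < r i) →
    ∃ (g : ℕ → ℕ) (C : Set ℝ), C.Countable ∧ ∀ x ∈ X, x ∉ C →
      ∀ᶠ n in atTop, ∃ m, n ≤ m ∧ m ≤ g n ∧ |x - e m| < r m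

/-! ### Families of functions under eventual domination -/

theorem exists_strictMono_eventually_dominating {S : Set (ℕ → ℕ)} (hS : S.Countable)
    (f : ℕ → ℕ) :
    ∃ g : ℕ → ℕ, StrictMono g ∧ (∀ n, f n ≤ g n) ∧ ∀ s ∈ S, ∀ᶠ n in atTop, s n < g n := by
  obtain ⟨u, hu⟩ := (hS.insert f).exists_eq_range (insert_nonempty _ _)
  let v : ℕ → ℕ := fun n => ∑ i ∈ Finset.range (n + 1), u i n + f n + 1
  have hv : ∀ n, v n ≤ ∑ j ∈ Finset.range (n + 1), v j := fun n =>
    Finset.single_le_sum (f := v) (fun _ _ => Nat.zero_le _) (Finset.self_mem_range_succ n)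
  refine ⟨fun n => ∑ j ∈ Finset.range (n + 1), v j, strictMono_nat_of_lt_succ fun n => ?_,
    fun n => le_trans (by simp only [v]; omega) (hv n), fun s hs => ?_⟩
  · rw [Finset.sum_range_succ _ (n + 1)]
    simp only [v]
    omega
  · obtain ⟨i, rfl⟩ : s ∈ range u := hu ▸ mem_insert_of_mem _ hs
    filter_upwards [eventually_ge_atTop i] with n hn
    refine lt_of_lt_of_le ?_ (hv n)
    have : u i n ≤ ∑ i ∈ Finset.range (n + 1), u i n :=
      Finset.single_le_sum (f := fun i => u i n) (fun _ _ => Nat.zero_le _)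
        (Finset.mem_range.2 (by omega))
    simp only [v]
    omega

theorem exists_increasing_scale {ι : Type*} [LinearOrder ι] [WellFoundedLT ι]
    (hι : ∀ a : ι, (Iio a).Countable) (f : ι → ℕ → ℕ) :
    ∃ h : ι → ℕ → ℕ, (∀ a, StrictMono (h a)) ∧ (∀ a n, f a n ≤ h a n) ∧
      ∀ a b, b < a → ∀ᶠ n in atTop, h b n < h a n := by
  have key : ∀ (a : ι) (p : ∀ b : ι, b < a → ℕ → ℕ), ∃ g : ℕ → ℕ, StrictMono g ∧
      (∀ n, f a n ≤ g n) ∧ ∀ b hb, ∀ᶠ n in atTop, p b hb n < g n := by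
    intro a p
    have : Countable (Iio a) := (hι a).to_subtype
    obtain ⟨g, h1, h2, h3⟩ := exists_strictMono_eventually_dominating
      (countable_range fun b : Iio a => p b.1 b.2) (f a)
    exact ⟨g, h1, h2, fun b hb => h3 _ ⟨⟨b, hb⟩, rfl⟩⟩
  choose G hG using key
  let h : ι → ℕ → ℕ := WellFoundedLT.fix G
  have hfix : ∀ a, h a = G a fun b _ => h b := fun a => WellFoundedLT.fix_eq G a
  refine ⟨h, fun a => ?_, fun a => ?_, fun a b hb => ?_⟩
  · rw [hfix]; exact (hG _ _).1
  · rw [hfix]; exact (hG _ _).2.1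
  · rw [hfix a]; exact (hG a fun b _ => h b).2.2 b hb

theorem StrictMono.exists_disjoint_iterate_block {h : ℕ → ℕ} (hh : StrictMono h) (p : ℕ → ℕ)
    {n : ℕ} (hn : p^[n + 1] n < h n) :
    ∃ j ≤ n, ∀ i, p^[j] n ≤ i → i < p^[j + 1] n → i ∉ range h := by
  classical
  have hex : ∃ j, p^[j + 1] n ≤ h j := ⟨n, hn.le⟩
  refine ⟨Nat.find hex, Nat.find_min' hex hn.le, ?_⟩
  have hspec := Nat.find_spec hex
  rintro _ h1 h2 ⟨i, rfl⟩
  have hlt : i < Nat.find hex := hh.lt_iff_lt.1 (h2.trans_le hspec)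
  obtain ⟨j, hj⟩ : ∃ j, Nat.find hex = j + 1 := ⟨Nat.find hex - 1, by omega⟩
  have hmin := Nat.find_min hex (m := j) (by omega)
  rw [hj] at h1 hlt
  exact hmin (h1.trans (hh.monotone (by omega)))

/-! ### Strong measure zero sets -/

theorem HasStrongMeasureZero.mono {X Y : Set ℝ} (h : X ⊆ Y) (hY : HasStrongMeasureZero Y) :
    HasStrongMeasureZero X := fun ε hε =>
  let ⟨U, hU, hYU⟩ := hY ε hε
  ⟨U, hU, h.trans hYU⟩

theorem ediam_ball_half_le (x ε : ℝ) :
    Metric.ediam (Metric.ball x (ε / 2)) ≤ ENNReal.ofReal ε := by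
  refine Metric.ediam_le_of_forall_dist_le fun a ha b hb => ?_
  have := dist_triangle_right a b x
  rw [Metric.mem_ball] at ha hb
  linarith

theorem HasStrongMeasureZero.exists_frequently_near {X : Set ℝ} (hX : HasStrongMeasureZero X)
    {L : ℝ} (hL : ∀ x ∈ X, |x| ≤ L) (hL0 : 0 ≤ L) {ε : ℕ → ℝ} (hε : ∀ n, 0 < ε n) :
    ∃ y : ℕ → ℝ, (∀ k, |y k| ≤ L) ∧ ∀ x ∈ X, ∃ᶠ k in atTop, |x - y k| < ε k := by
  have key : ∀ ε : ℕ → ℝ, (∀ n, 0 < ε n) → ∃ y : ℕ → ℝ, (∀ k, |y k| ≤ L) ∧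
      ∀ x ∈ X, ∃ k, |x - y k| < ε k := by
    intro ε hε
    obtain ⟨U, hU, hXU⟩ := hX (fun n => ε n / 2) fun n => half_pos (hε n)
    have : ∀ n, ∃ y : ℝ, |y| ≤ L ∧ ∀ x ∈ X, x ∈ U n → |x - y| < ε n := by
      intro n
      by_cases hne : (U n ∩ X).Nonempty
      · obtain ⟨y, hyU, hyX⟩ := hne
        refine ⟨y, hL y hyX, fun x _ hxU => ?_⟩
        have h1 := (Metric.edist_le_ediam_of_mem hxU hyU).trans (hU n)
        rw [edist_dist, ENNReal.ofReal_le_ofReal_iff (half_pos (hε n)).le, Real.dist_eq] at h1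
        linarith [hε n]
      · exact ⟨0, by simpa using hL0, fun x hx hxU => (hne ⟨x, hxU, hx⟩).elim⟩
    choose y hy1 hy2 using this
    refine ⟨y, hy1, fun x hx => ?_⟩
    obtain ⟨n, hn⟩ := mem_iUnion.1 (hXU hx)
    exact ⟨n, hy2 n x hx hn⟩
  choose y hy1 hy2 using fun i : ℕ => key (fun j => ε (Nat.pair i j)) fun j => hε _
  refine ⟨fun k => y k.unpair.1 k.unpair.2, fun k => hy1 _ _, fun x hx => ?_⟩
  refine frequently_atTop.2 fun i => ?_
  obtain ⟨j, hj⟩ := hy2 i x hx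
  exact ⟨Nat.pair i j, Nat.left_le_pair i j, by simpa using hj⟩

theorem IsUniformlyConcentrated.hasStrongMeasureZero {X : Set ℝ}
    (hX : IsUniformlyConcentrated X) : HasStrongMeasureZero X := by
  obtain ⟨e, -, he⟩ := hX
  intro ε hε
  obtain ⟨g, C, hC, hg⟩ := he (fun m => ε (2 * m) / 2) fun m => half_pos (hε _)
  obtain ⟨c, hc⟩ := (hC.insert 0).exists_eq_range (insert_nonempty _ _)
  refine ⟨fun n => if Even n then Metric.ball (e (n / 2)) (ε n / 2) else {c (n / 2)},
    fun n => ?_, fun x hx => mem_iUnion.2 ?_⟩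
  · dsimp only
    split_ifs
    · exact ediam_ball_half_le _ _
    · exact Metric.ediam_singleton.trans_le zero_le
  · by_cases hxC : x ∈ C
    · obtain ⟨m, rfl⟩ : x ∈ range c := hc ▸ mem_insert_of_mem _ hxC
      refine ⟨2 * m + 1, ?_⟩
      have h1 : ¬ Even (2 * m + 1) := by simp
      have h2 : (2 * m + 1) / 2 = m := by omega
      simp [h1, h2]
    · obtain ⟨n, m, -, -, hm⟩ := (hg x hx hxC).exists
      refine ⟨2 * m, ?_⟩
      simpa [Metric.mem_ball, Real.dist_eq] using hm

theorem IsUniformlyConcentrated.hasHurewiczProperty {X : Set ℝ}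
    (hX : IsUniformlyConcentrated X) : HasHurewiczProperty X := by
  obtain ⟨e, heX, he⟩ := hX
  intro S hS hXS
  have h1 : ∀ i, ∃ k, i ≤ k ∧ e i ∈ S k := fun i => frequently_atTop.1 (hXS _ (heX i)) i
  choose k hik hk using h1
  have h2 : ∀ i, ∃ r > 0, Metric.ball (e i) r ⊆ S (k i) := fun i =>
    Metric.isOpen_iff.1 (hS _) _ (hk i)
  choose r hr hrS using h2
  obtain ⟨g, C, hC, hg⟩ := he r hr
  have h3 : ∀ x : X, ∀ n, ∃ k, n ≤ k ∧ x.1 ∈ S k := fun x => frequently_atTop.1 (hXS _ x.2)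
  choose u hu huS using h3
  have hC' : ({x : X | x.1 ∈ C}).Countable := hC.preimage Subtype.val_injective
  obtain ⟨G, -, hG, hGu⟩ := exists_strictMono_eventually_dominating (hC'.image u)
    fun n => (Finset.range (g n + 1)).sup k + 1
  refine ⟨G, fun x hx => ?_⟩
  by_cases hxC : x ∈ C
  · filter_upwards [hGu _ (mem_image_of_mem u (show (⟨x, hx⟩ : X) ∈ {x : X | x.1 ∈ C} from hxC))]
      with n hn
    exact ⟨u ⟨x, hx⟩ n, hu _ _, hn, huS ⟨x, hx⟩ n⟩
  · filter_upwards [hg x hx hxC] with n ⟨m, hnm, hmg, hm⟩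
    refine ⟨k m, hnm.trans (hik m), ?_, hrS m ?_⟩
    · have : k m ≤ (Finset.range (g n + 1)).sup k :=
        Finset.le_sup (Finset.mem_range.2 (by omega))
      have := hG n
      omega
    · rwa [Metric.mem_ball, Real.dist_eq]

/-! ### Meager-additive sets -/

theorem IsMeagerAdditive.hasStrongMeasureZero {X : Set ℝ} (hX : IsMeagerAdditive X) :
    HasStrongMeasureZero X := by
  intro ε hε
  let q := TopologicalSpace.denseSeq ℝ
  let U : Set ℝ := ⋃ n, Metric.ball (q n) (ε n / 2)
  have hUo : IsOpen U := isOpen_iUnion fun _ => Metric.isOpen_ball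
  have hUd : Dense U := (TopologicalSpace.denseRange_denseSeq ℝ).mono <| by
    rintro _ ⟨n, rfl⟩
    exact mem_iUnion.2 ⟨n, Metric.mem_ball_self (half_pos (hε n))⟩
  have hM : IsMeagre Uᶜ := by
    rw [IsMeagre, compl_compl]
    exact residual_of_dense_open hUo hUd
  have hne : X + Uᶜ ≠ univ := fun h =>
    not_isMeagre_of_isOpen isOpen_univ univ_nonempty (h ▸ hX _ hM)
  obtain ⟨z, hz⟩ := (ne_univ_iff_exists_notMem _).1 hne
  refine ⟨fun n => Metric.ball (z - q n) (ε n / 2), fun n => ediam_ball_half_le _ _,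
    fun x hx => ?_⟩
  have hzx : z - x ∈ U := by
    by_contra h
    exact hz ⟨x, hx, z - x, h, by simp⟩
  obtain ⟨n, hn⟩ := mem_iUnion.1 hzx
  refine mem_iUnion.2 ⟨n, ?_⟩
  rw [Metric.mem_ball, Real.dist_eq] at hn ⊢
  rwa [← abs_neg, show -(x - (z - q n)) = z - x - q n by ring]

theorem IsMeagre.exists_antitone_dense_open {M : Set ℝ} (hM : IsMeagre M) :
    ∃ D : ℕ → Set ℝ, Antitone D ∧ (∀ n, IsOpen (D n)) ∧ (∀ n, Dense (D n)) ∧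
      ∀ x ∈ M, ∃ n, x ∉ D n := by
  obtain ⟨S, hSo, hSd, hSc, hSM⟩ := mem_residual_iff.1 hM
  obtain ⟨u, hu⟩ := (hSc.insert univ).exists_eq_range (insert_nonempty _ _)
  have hu' : ∀ i, IsOpen (u i) ∧ Dense (u i) := by
    intro i
    rcases (hu ▸ mem_range_self i : u i ∈ insert univ S) with h | h
    · rw [h]; exact ⟨isOpen_univ, dense_univ⟩
    · exact ⟨hSo _ h, hSd _ h⟩
  refine ⟨fun n => ⋂ i ∈ Iic n, u i, fun m n hmn => biInter_subset_biInter_left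
    (Iic_subset_Iic.2 hmn), fun n => (finite_Iic n).isOpen_biInter fun i _ => (hu' i).1,
    fun n => dense_biInter_of_isOpen (fun i _ => (hu' i).1) (to_countable _)
      fun i _ => (hu' i).2, fun x hx => ?_⟩
  by_contra! h
  refine hSM (fun s hs => ?_) hx
  obtain ⟨i, rfl⟩ : s ∈ range u := hu ▸ mem_insert_of_mem _ hs
  exact mem_iInter₂.1 (h i) i (mem_Iic.2 le_rfl)

theorem exists_uniform_ball_subset {D : Set ℝ} (hDo : IsOpen D) (hDd : Dense D) (L : ℝ)
    {η : ℝ} (hη : 0 < η) :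
    ∃ ε > 0, ∀ a : ℝ, |a| ≤ L → ∃ c, |c - a| < η ∧ Metric.ball c ε ⊆ D := by
  have : ∃ ε > 0, ∀ a ∈ Metric.closedBall (0 : ℝ) L, ∃ c, |c - a| < η ∧
      Metric.ball c ε ⊆ D := by
    refine (isCompact_closedBall (0 : ℝ) L).induction_on
      (p := fun s => ∃ ε > 0, ∀ a ∈ s, ∃ c, |c - a| < η ∧ Metric.ball c ε ⊆ D)
      ⟨1, one_pos, by simp⟩ ?_ ?_ ?_
    · rintro s t hst ⟨ε, hε, h⟩
      exact ⟨ε, hε, fun a ha => h a (hst ha)⟩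
    · rintro s t ⟨ε, hε, h⟩ ⟨ε', hε', h'⟩
      refine ⟨min ε ε', lt_min hε hε', ?_⟩
      rintro a (ha | ha)
      · obtain ⟨c, hc, hcD⟩ := h a ha
        exact ⟨c, hc, (Metric.ball_subset_ball (min_le_left _ _)).trans hcD⟩
      · obtain ⟨c, hc, hcD⟩ := h' a ha
        exact ⟨c, hc, (Metric.ball_subset_ball (min_le_right _ _)).trans hcD⟩
    · intro a _
      obtain ⟨c, hcD, hc⟩ := hDd.exists_dist_lt a (half_pos hη)
      obtain ⟨ε, hε, hεD⟩ := Metric.isOpen_iff.1 hDo c hcD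
      refine ⟨Metric.ball a (η / 2), mem_nhdsWithin_of_mem_nhds
        (Metric.ball_mem_nhds _ (half_pos hη)), ε, hε, fun b hb => ⟨c, ?_, hεD⟩⟩
      rw [Metric.mem_ball] at hb
      rw [← Real.dist_eq]
      have := dist_triangle c a b
      rw [dist_comm c a, dist_comm a b] at this
      linarith
  simpa using this

theorem HasStrongMeasureZero.isMeagerAdditive_of_hasHurewiczProperty {X : Set ℝ}
    (hX : HasStrongMeasureZero X) (hH : HasHurewiczProperty X) {L : ℝ}
    (hL : ∀ x ∈ X, |x| ≤ L) (hL0 : 0 ≤ L) : IsMeagerAdditive X := by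
  intro M hM
  obtain ⟨D, hDanti, hDo, hDd, hDM⟩ := hM.exists_antitone_dense_open
  have hE : ∀ (k : ℕ) (η : ℝ), ∃ ε > 0, 0 < η → ∀ a : ℝ, |a| ≤ k + 1 + L →
      ∃ c, |c - a| < η ∧ Metric.ball c ε ⊆ D k := by
    intro k η
    by_cases hη : 0 < η
    · obtain ⟨ε, hε, h⟩ := exists_uniform_ball_subset (hDo k) (hDd k) (k + 1 + L) hη
      exact ⟨ε, hε, fun _ => h⟩
    · exact ⟨1, one_pos, fun h => (hη h).elim⟩
  choose E hE0 hE using hE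
  let d : ℕ → ℝ := fun n => Nat.rec 1 (fun k x => min (E k x) x / 4) n
  have hd0 : d 0 = 1 := rfl
  have hds : ∀ k, d (k + 1) = min (E k (d k)) (d k) / 4 := fun k => rfl
  have hdpos : ∀ k, 0 < d k := by
    intro k
    induction k with
    | zero => rw [hd0]; exact one_pos
    | succ k ih => rw [hds]; have := lt_min (hE0 k (d k)) ih; positivity
  have hdle : ∀ k, d (k + 1) ≤ d k / 4 := fun k => by
    rw [hds]; have := min_le_right (E k (d k)) (d k); linarith
  have hdE : ∀ k, 4 * d (k + 1) ≤ E k (d k) := fun k => by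
    rw [hds]; have := min_le_left (E k (d k)) (d k); linarith
  have hdanti : Antitone d := antitone_nat_of_succ_le fun k => by
    have := hdle k; have := hdpos k; linarith
  have hd1 : ∀ k, d k ≤ 1 := fun k => hdanti (Nat.zero_le k)
  have hdpow : ∀ k, d k ≤ (1 / 4) ^ k := by
    intro k
    induction k with
    | zero => simp [hd0]
    | succ k ih => rw [pow_succ]; have := hdle k; linarith
  have hdlim : Tendsto d atTop (𝓝 0) :=
    squeeze_zero (fun k => (hdpos k).le) hdpow
      (tendsto_pow_atTop_nhds_zero_of_lt_one (by norm_num) (by norm_num))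
  obtain ⟨y, hyL, hy⟩ := hX.exists_frequently_near hL hL0 (ε := fun k => d (k + 1))
    fun k => hdpos (k + 1)
  obtain ⟨g, hg⟩ := hH (fun k => Metric.ball (y k) (d (k + 1))) (fun k => Metric.isOpen_ball)
    (by simpa only [Metric.mem_ball, Real.dist_eq] using hy)
  have hchain : ∀ j n : ℕ, ∀ a : ℝ, |a| ≤ n + 1 → ∃ z, |z - a| < 2 * d n ∧
      ∀ k, n ≤ k → k < n + j → Metric.ball (z - y k) (2 * d (k + 1)) ⊆ D k := by
    intro j
    induction j with
    | zero => exact fun n a _ => ⟨a, by simpa using hdpos n, fun k _ _ => by omega⟩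
    | succ j ih =>
      intro n a ha
      obtain ⟨c, hca, hcD⟩ := hE n (d n) (hdpos n) (a - y n)
        ((abs_sub _ _).trans (add_le_add ha (hyL n)))
      have hca' : |c + y n - a| < d n := by
        rwa [show c + y n - a = c - (a - y n) by ring]
      obtain ⟨z, hz, hzD⟩ := ih (n + 1) (c + y n) (by
        push_cast
        have := abs_add_le (c + y n - a) a
        rw [sub_add_cancel] at this
        linarith [hd1 n])
      refine ⟨z, ?_, fun k hnk hkn => ?_⟩
      · have := abs_sub_le z (c + y n) a
        linarith [hdle n, hdpos n]
      · rcases hnk.eq_or_lt with rfl | hlt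
        · refine (Metric.ball_subset_ball' ?_).trans hcD
          rw [Real.dist_eq, show z - y n - c = z - (c + y n) by ring]
          linarith [hdE n]
        · exact hzD k hlt (by omega)
  let W : ℕ → Set ℝ := fun n => ⋃ z ∈ {z : ℝ | ∀ k, n ≤ k → k < g n →
    Metric.ball (z - y k) (2 * d (k + 1)) ⊆ D k}, Metric.ball z (d (g n))
  have hWo : ∀ n, IsOpen (W n) := fun n => isOpen_biUnion fun _ _ => Metric.isOpen_ball
  have hWd : ∀ N, Dense (⋃ n ≥ N, W n) := by
    intro N
    refine Metric.dense_iff.2 fun a η hη => ?_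
    obtain ⟨n, h1, h2, h3⟩ := ((hdlim.eventually (gt_mem_nhds (half_pos hη))).and
      ((tendsto_natCast_atTop_atTop.eventually_ge_atTop |a|).and
        (eventually_ge_atTop N))).exists
    obtain ⟨z, hz, hzD⟩ := hchain (g n) n a (by linarith)
    refine ⟨z, ?_, mem_iUnion₂.2 ⟨n, h3, mem_iUnion₂.2
      ⟨z, fun k hk hkg => hzD k hk (by omega), Metric.mem_ball_self (hdpos _)⟩⟩⟩
    rw [Metric.mem_ball, Real.dist_eq]
    linarith
  have hres : (⋂ N, ⋃ n ≥ N, W n) ∈ residual ℝ := countable_iInter_mem.2 fun N =>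
    residual_of_dense_open (isOpen_biUnion fun n _ => hWo n) (hWd N)
  refine mem_of_superset hres ?_
  rintro _ hz ⟨x, hx, m, hm, rfl⟩
  obtain ⟨p, hp⟩ := hDM m hm
  obtain ⟨N, hN⟩ := eventually_atTop.1 (hg x hx)
  obtain ⟨n, hn, hnW⟩ := mem_iUnion₂.1 (mem_iInter.1 hz (max N p))
  obtain ⟨z, hzD, hzn⟩ := mem_iUnion₂.1 hnW
  obtain ⟨k, hnk, hkg, hxk⟩ := hN n ((le_max_left _ _).trans hn)
  refine hp (hDanti (((le_max_right _ _).trans hn).trans hnk) (hzD k hnk hkg ?_))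
  rw [Metric.mem_ball, Real.dist_eq] at hzn hxk ⊢
  have h1 : d (g n) ≤ d (k + 1) := hdanti hkg
  have h2 := abs_sub (x + m - z) (x - y k)
  rw [show x + m - z - (x - y k) = m - (z - y k) by ring] at h2
  linarith

/-! ### Uniformly concentrated sets from an unbounded scale -/

/-- The real number with ternary digits `0` and `1` prescribed by `f`. -/
noncomputable def ternaryReal (f : ℕ → Bool) : ℝ := Cardinal.cantorFunction (1 / 3) f

theorem ternaryReal_nonneg (f : ℕ → Bool) : 0 ≤ ternaryReal f :=
  tsum_nonneg fun _ => Cardinal.cantorFunctionAux_nonneg (by norm_num)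

theorem ternaryReal_le (f : ℕ → Bool) : ternaryReal f ≤ 2 := by
  have h := Cardinal.cantorFunction_le (c := 1 / 3) (f := f) (g := fun _ => true)
    (by norm_num) (by norm_num) (by simp)
  have h2 := Cardinal.cantorFunction_succ (c := 1 / 3) (fun _ => true)
    (by norm_num) (by norm_num)
  simp only [cond_true] at h2
  unfold ternaryReal
  linarith

theorem abs_ternaryReal_sub_le (k : ℕ) : ∀ f f' : ℕ → Bool, (∀ i < k, f i = f' i) →
    |ternaryReal f - ternaryReal f'| ≤ 2 * (1 / 3) ^ k := by
  induction k with
  | zero =>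
    intro f f' _
    rw [abs_le]
    constructor <;>
      linarith [ternaryReal_nonneg f, ternaryReal_nonneg f', ternaryReal_le f, ternaryReal_le f']
  | succ k ih =>
    intro f f' h
    have h1 := ih (fun n => f (n + 1)) (fun n => f' (n + 1)) fun i hi => h _ (by omega)
    have hf := Cardinal.cantorFunction_succ (c := 1 / 3) f (by norm_num) (by norm_num)
    have hf' := Cardinal.cantorFunction_succ (c := 1 / 3) f' (by norm_num) (by norm_num)
    unfold ternaryReal at h1 ⊢
    rw [hf, hf', h 0 (by omega), add_sub_add_left_eq_sub, ← mul_sub, abs_mul, pow_succ,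
      abs_of_pos (by norm_num : (0 : ℝ) < 1 / 3)]
    linarith

theorem ternaryReal_injective : Function.Injective ternaryReal :=
  Cardinal.cantorFunction_injective (by norm_num) (by norm_num)

/-- An enumeration of the reals with finitely many ternary digits `1` and all others `0`, in
which every such real occurs infinitely often. -/
noncomputable def ternaryRational (m : ℕ) : ℝ := ternaryReal (Nat.testBit m.unpair.1)

theorem exists_ternaryRational_near {r : ℕ → ℝ} (hr : ∀ i, 0 < r i) :
    ∃ p : ℕ → ℕ, (∀ k, k ≤ p k) ∧ ∀ (k : ℕ) (f : ℕ → Bool),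
      (∀ i, k ≤ i → i < p k → f i = false) →
      ∃ m, k ≤ m ∧ m ≤ Nat.pair (2 ^ k) k ∧ |ternaryReal f - ternaryRational m| < r m := by
  have hlim : Tendsto (fun p : ℕ => 2 * (1 / 3 : ℝ) ^ p) atTop (𝓝 0) := by
    simpa using (tendsto_pow_atTop_nhds_zero_of_lt_one (r := (1 / 3 : ℝ)) (by norm_num)
      (by norm_num)).const_mul 2
  have hex : ∀ k : ℕ, ∃ p, k ≤ p ∧ ∀ a ∈ Finset.range (2 ^ k),
      2 * (1 / 3 : ℝ) ^ p < r (Nat.pair a k) := fun k =>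
    ((eventually_ge_atTop k).and ((Finset.eventually_all _).2 fun a _ =>
      hlim.eventually (gt_mem_nhds (hr (Nat.pair a k))))).exists
  choose p hkp hp using hex
  refine ⟨p, hkp, fun k f hf => ?_⟩
  let a := Nat.ofBits fun i : Fin k => f i
  have ha : a < 2 ^ k := Nat.ofBits_lt_two_pow _
  refine ⟨Nat.pair a k, Nat.right_le_pair _ _, (Nat.pair_lt_pair_left k ha).le,
    (abs_ternaryReal_sub_le (p k) _ _ fun i hi => ?_).trans_lt
      (hp k a (Finset.mem_range.2 ha))⟩
  rw [Nat.unpair_pair, Nat.testBit_ofBits]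
  split_ifs with hik
  · rfl
  · exact hf i (by omega) hi

theorem exists_uncountable_isUniformlyConcentrated {ι : Type*} [LinearOrder ι]
    [WellFoundedLT ι] [Uncountable ι] (hι : ∀ a : ι, (Iio a).Countable) {f : ι → ℕ → ℕ}
    (hf : ∀ G : ℕ → ℕ, ∃ a, ∃ᶠ n in atTop, G n < f a n) :
    ∃ X : Set ℝ, ¬ X.Countable ∧ (∀ x ∈ X, |x| ≤ 2) ∧ IsUniformlyConcentrated X := by
  classical
  obtain ⟨h, hmono, hfh, hlt⟩ := exists_increasing_scale hι f
  let x : ι → ℝ := fun a => ternaryReal fun i => decide (i ∈ range (h a))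
  have hx : Function.Injective x := by
    intro a b hab
    have hab' := ternaryReal_injective hab
    have hr : range (h a) = range (h b) := by
      ext i
      simpa using congrFun hab' i
    have heq : h a = h b := (StrictMono.range_inj (hmono a) (hmono b)).1 hr
    rcases lt_trichotomy a b with hl | hl | hl
    · obtain ⟨n, hn⟩ := (hlt b a hl).exists
      rw [heq] at hn
      exact (lt_irrefl _ hn).elim
    · exact hl
    · obtain ⟨n, hn⟩ := (hlt a b hl).exists
      rw [heq] at hn
      exact (lt_irrefl _ hn).elim
  refine ⟨range x ∪ range ternaryRational, fun hc => ?_, ?_, ternaryRational,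
    fun i => Or.inr (mem_range_self i), fun r hr => ?_⟩
  · have : (range x).Countable := hc.mono subset_union_left
    have hcu : (univ : Set ι).Countable := by
      rw [← image_univ] at this
      exact countable_of_injective_of_countable_image hx.injOn this
    exact not_countable (α := ι) (countable_univ_iff.1 hcu)
  · rintro _ (⟨a, rfl⟩ | ⟨m, rfl⟩) <;>
      exact (abs_of_nonneg (ternaryReal_nonneg _)).trans_le (ternaryReal_le _)
  · obtain ⟨p, hkp, hp⟩ := exists_ternaryRational_near hr
    obtain ⟨a₀, ha₀⟩ := hf fun n => p^[n + 1] n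
    choose N hnN hN using frequently_atTop.1 ha₀
    let B : ℕ → ℕ := fun n =>
      (Finset.range (n + 1)).sup fun j => Nat.pair (2 ^ p^[j] n) (p^[j] n)
    refine ⟨fun n => B (N n), x '' Iic a₀ ∪ range ternaryRational,
      (Countable.image (by
        rw [← Iio_insert]
        exact (hι a₀).insert _) _).union (countable_range _), ?_⟩
    rintro _ (⟨a, rfl⟩ | hm) hnot
    · have haa : a₀ < a := by
        by_contra hle
        exact hnot (Or.inl ⟨a, not_lt.1 hle, rfl⟩)
      obtain ⟨n₀, hn₀⟩ := eventually_atTop.1 (hlt a a₀ haa)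
      filter_upwards [eventually_ge_atTop n₀] with n hn
      have hbig : p^[N n + 1] (N n) < h a (N n) :=
        ((hN n).trans_le (hfh a₀ _)).trans (hn₀ _ (hn.trans (hnN n)))
      obtain ⟨j, hj, hblock⟩ := (hmono a).exists_disjoint_iterate_block p hbig
      obtain ⟨m, hkm, hmP, hmr⟩ := hp (p^[j] (N n)) (fun i => decide (i ∈ range (h a)))
        fun i hi hi' => decide_eq_false (hblock i hi (by
          rwa [Function.iterate_succ_apply']))
      have hNj : N n ≤ p^[j] (N n) := Function.id_le_iterate_of_id_le hkp j (N n)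
      exact ⟨m, ((hnN n).trans hNj).trans hkm, hmP.trans
        (Finset.le_sup (f := fun j => Nat.pair (2 ^ p^[j] (N n)) (p^[j] (N n)))
          (Finset.mem_range.2 (by omega))), hmr⟩
    · exact (hnot (Or.inr hm)).elim

theorem exists_uncountable_isMeagerAdditive {X : Set ℝ} (hX : HasStrongMeasureZero X)
    (hXc : ¬ X.Countable) : ∃ Y : Set ℝ, ¬ Y.Countable ∧ IsMeagerAdditive Y := by
  let ι : Type := (Cardinal.aleph 1).ord.ToType
  have hιcard : Cardinal.mk ι = Cardinal.aleph 1 := Cardinal.mk_ord_toType _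
  have hι : ∀ a : ι, (Iio a).Countable := fun a => by
    rw [← Cardinal.le_aleph0_iff_set_countable, ← Cardinal.lt_aleph_one_iff]
    exact (Cardinal.mk_Iio_lt a (by rw [hιcard, Ordinal.type_toType])).trans_eq hιcard
  have hιu : Uncountable ι := by
    rw [← Cardinal.aleph0_lt_mk_iff, hιcard]
    exact Cardinal.aleph0_lt_aleph_one
  by_cases hb : ∀ f : ι → ℕ → ℕ, ∃ G : ℕ → ℕ, ∀ a, ∀ᶠ n in atTop, f a n ≤ G n
  · obtain ⟨L, hL⟩ : ∃ L : ℕ, ¬ (X ∩ {x | |x| ≤ L}).Countable := by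
      by_contra! hall
      refine hXc ((countable_iUnion hall).mono fun x hx => ?_)
      obtain ⟨L, hL⟩ := exists_nat_ge |x|
      exact mem_iUnion.2 ⟨L, hx, hL⟩
    have hle : Cardinal.mk ι ≤ Cardinal.mk ↥(X ∩ {x | |x| ≤ L}) := by
      rw [hιcard]
      exact not_lt.1 fun hlt => hL
        (Cardinal.le_aleph0_iff_set_countable.1 (Cardinal.lt_aleph_one_iff.1 hlt))
    obtain ⟨x⟩ := hle
    let Y : Set ℝ := range fun a => (x a : ℝ)
    have hYX : ∀ y ∈ Y, y ∈ X ∩ {x | |x| ≤ L} := by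
      rintro _ ⟨a, rfl⟩
      exact (x a).2
    refine ⟨Y, fun hc => ?_,
      (hX.mono fun y hy => (hYX y hy).1).isMeagerAdditive_of_hasHurewiczProperty ?_
      (fun y hy => (hYX y hy).2) (Nat.cast_nonneg L)⟩
    · have hinj : Function.Injective fun a => (x a : ℝ) :=
        Subtype.val_injective.comp x.injective
      have : Countable ι := countable_univ_iff.1
        (countable_of_injective_of_countable_image hinj.injOn (by rwa [image_univ]))
      exact not_countable (α := ι) this
    · intro S _ hS
      have hu : ∀ (a : ι) (n : ℕ), ∃ k, n ≤ k ∧ (x a : ℝ) ∈ S k := fun a =>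
        frequently_atTop.1 (hS _ (mem_range_self a))
      choose u hnu huS using hu
      obtain ⟨G, hG⟩ := hb u
      refine ⟨fun n => G n + 1, ?_⟩
      rintro _ ⟨a, rfl⟩
      filter_upwards [hG a] with n hn
      exact ⟨u a n, hnu a n, Nat.lt_succ_of_le hn, huS a n⟩
  · push Not at hb
    obtain ⟨f, hf⟩ := hb
    obtain ⟨Y, hYc, hY2, hY⟩ := exists_uncountable_isUniformlyConcentrated hι hf
    exact ⟨Y, hYc, hY.hasStrongMeasureZero.isMeagerAdditive_of_hasHurewiczProperty
      hY.hasHurewiczProperty hY2 zero_le_two⟩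

/-- Every strong measure zero set of reals is countable if, and only if, every
meager-additive set of reals is countable. -/
theorem borelConjecture_iff_meagerAdditive_countable :
    (∀ X : Set ℝ, HasStrongMeasureZero X → X.Countable) ↔
    (∀ X : Set ℝ, IsMeagerAdditive X → X.Countable) := by
  refine ⟨fun h X hX => h X hX.hasStrongMeasureZero, fun h X hX => ?_⟩
  by_contra hXc
  obtain ⟨Y, hYc, hY⟩ := exists_uncountable_isMeagerAdditive hX hXc
  exact hYc (h Y hY)
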